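/- arXiv:2605.21676 — 5 statements merged into one kernel-verified Lean document; each statement's English description precedes it below -/
import Mathlib

section
/- For every signal stream S with strictly increasing times, every window size w > 0, and every step k with 1 ≤ k ≤ n, the front value of the monotonic deque state Σ_k obtained by processing the first k samples equals the naive sliding-window minimum: R_deque(Σ_k) = R_naive(k) = min{v_i : 1 ≤ i ≤ k and t_k − w ≤ t_i ≤ t_k}. -/
open scoped Classical

/-- One processing step of the monotonic min-deque for window size `w`:
PopFront (drop expired times `< tk - w`), PopBack (drop back values `> vk`),
then PushBack `(tk, vk)`. -/
noncomputable def dequeStep (w tk vk : ℝ) (D : List (ℝ × ℝ)) : List (ℝ × ℝ) :=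
  (((D.dropWhile (fun p => decide (p.1 < tk - w))).reverse.dropWhile
      (fun p => decide (vk < p.2))).reverse) ++ [(tk, vk)]

/-- The deque state `Σ_k` after processing samples `1, …, k` of the stream
`(t i, v i)`, starting from the empty deque. -/
noncomputable def dequeRun (w : ℝ) (t v : ℕ → ℝ) : ℕ → List (ℝ × ℝ)
  | 0 => []
  | (k+1) => dequeStep w (t (k+1)) (v (k+1)) (dequeRun w t v k)

/-- The naive sliding-window minimum `R_naive(k)`: the minimum (infimum) of the
finite nonempty set of in-window values `{v i : 1 ≤ i ≤ k, t k - w ≤ t i ≤ t k}`. -/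
noncomputable def naiveMin (w : ℝ) (t v : ℕ → ℝ) (k : ℕ) : ℝ :=
  sInf (v '' {i | 1 ≤ i ∧ i ≤ k ∧ t k - w ≤ t i ∧ t i ≤ t k})

theorem mem_dropWhile_of_pairwise {α : Type*} (f : α → Bool) (l : List α)
    (h : l.Pairwise (fun a b => f b = true → f a = true)) (x : α) :
    x ∈ l.dropWhile f ↔ x ∈ l ∧ f x = false := by
  induction l with
  | nil => simp
  | cons a l ih =>
    rw [List.pairwise_cons] at h
    obtain ⟨h1, h2⟩ := h
    cases ha : f a with
    | true =>
      rw [List.dropWhile_cons_of_pos ha, ih h2, List.mem_cons]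
      constructor
      · rintro ⟨h3, h4⟩
        exact ⟨Or.inr h3, h4⟩
      · rintro ⟨rfl | h3, h4⟩
        · simp [ha] at h4
        · exact ⟨h3, h4⟩
    | false =>
      rw [List.dropWhile_cons_of_neg (by simp [ha])]
      constructor
      · intro hx
        refine ⟨hx, ?_⟩
        rcases List.mem_cons.1 hx with rfl | hx
        · exact ha
        · cases hfx : f x with
          | false => rfl
          | true => simp [h1 x hx hfx] at ha
      · exact fun hx => hx.1

theorem dequeStep_spec (w tk vk : ℝ) (D : List (ℝ × ℝ))
    (hD : D.Pairwise (fun p q => p.1 < q.1 ∧ p.2 ≤ q.2)) (hlt : ∀ p ∈ D, p.1 < tk) :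
    (∀ p, p ∈ dequeStep w tk vk D ↔ (p ∈ D ∧ tk - w ≤ p.1 ∧ p.2 ≤ vk) ∨ p = (tk, vk)) ∧
    (dequeStep w tk vk D).Pairwise (fun p q => p.1 < q.1 ∧ p.2 ≤ q.2) := by
  have hA := hD.sublist (List.dropWhile_sublist (fun p => decide (p.1 < tk - w)))
  have hB := (List.reverse_sublist.2 (List.dropWhile_sublist (fun p : ℝ × ℝ => decide (vk < p.2))
    (l := (D.dropWhile (fun p => decide (p.1 < tk - w))).reverse)))
  rw [List.reverse_reverse] at hB
  have hm : ∀ p, p ∈ dequeStep w tk vk D ↔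
      (p ∈ D ∧ tk - w ≤ p.1 ∧ p.2 ≤ vk) ∨ p = (tk, vk) := by
    intro p
    unfold dequeStep
    rw [List.mem_append, List.mem_reverse, mem_dropWhile_of_pairwise, List.mem_reverse,
      mem_dropWhile_of_pairwise]
    · simp [and_assoc]
    · refine hD.imp ?_
      intro a b hab h
      simp only [decide_eq_true_eq] at *
      linarith [hab.1]
    · rw [List.pairwise_reverse]
      refine hA.imp ?_
      intro a b hab h
      simp only [decide_eq_true_eq] at *
      linarith [hab.2]
  refine ⟨hm, ?_⟩
  have hm' := fun p => (hm p).1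
  unfold dequeStep at hm' ⊢
  rw [List.pairwise_append]
  refine ⟨hA.sublist hB, by simp, ?_⟩
  intro a ha b hb
  rw [List.mem_singleton] at hb
  subst hb
  have haD : a ∈ D := (List.dropWhile_sublist _).subset (hB.subset ha)
  refine ⟨hlt a haD, ?_⟩
  rcases hm' a (List.mem_append_left _ ha) with h | h
  · exact h.2.2
  · rw [h]

theorem dequeRun_inv (n : ℕ) (t v : ℕ → ℝ) (w : ℝ)
    (hmono : ∀ i j, 1 ≤ i → i < j → j ≤ n → t i < t j) (hw : 0 < w) (k : ℕ) (hkn : k ≤ n) :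
    (∀ p ∈ dequeRun w t v k, ∃ i, 1 ≤ i ∧ i ≤ k ∧ p = (t i, v i) ∧ t k - w ≤ t i) ∧
    (dequeRun w t v k).Pairwise (fun p q => p.1 < q.1 ∧ p.2 ≤ q.2) ∧
    (∀ i, 1 ≤ i → i ≤ k → t k - w ≤ t i → ∃ p ∈ dequeRun w t v k, t i ≤ p.1 ∧ p.2 ≤ v i) := by
  induction k with
  | zero =>
    refine ⟨by simp [dequeRun], by simp [dequeRun], ?_⟩
    intro i h1 h2
    omega
  | succ k ih =>
    obtain ⟨ha, hb, hc⟩ := ih (by omega)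
    have hlt : ∀ p ∈ dequeRun w t v k, p.1 < t (k+1) := by
      intro p hp
      obtain ⟨i, h1, h2, rfl, -⟩ := ha p hp
      exact hmono i (k+1) h1 (by omega) hkn
    obtain ⟨hm, hp⟩ := dequeStep_spec w (t (k+1)) (v (k+1)) _ hb hlt
    simp only [dequeRun]
    refine ⟨?_, hp, ?_⟩
    · intro p hp
      rcases (hm p).1 hp with ⟨h1, h2, h3⟩ | rfl
      · obtain ⟨i, g1, g2, rfl, -⟩ := ha p h1
        exact ⟨i, g1, by omega, rfl, h2⟩
      · exact ⟨k+1, by omega, le_rfl, rfl, by linarith⟩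
    · intro i h1 h2 h3
      rcases Nat.lt_or_ge k i with h | h
      · obtain rfl : i = k + 1 := by omega
        exact ⟨_, (hm _).2 (Or.inr rfl), le_rfl, le_rfl⟩
      · have hk := hmono k (k+1) (by omega) (by omega) hkn
        obtain ⟨p, hpD, hp1, hp2⟩ := hc i h1 h (by linarith)
        by_cases hv : p.2 ≤ v (k+1)
        · exact ⟨p, (hm _).2 (Or.inl ⟨hpD, by linarith, hv⟩), hp1, hp2⟩
        · exact ⟨_, (hm _).2 (Or.inr rfl), (hmono i (k+1) h1 (by omega) hkn).le,
            by simp only; linarith⟩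

/-- **Correctness of the monotonic deque.** For every signal stream with strictly
increasing times, every window size `w > 0`, and every step `1 ≤ k ≤ n`, the
deque state `Σ_k` is nonempty and its front value equals the naive
sliding-window minimum `R_naive(k)`. -/
theorem deque_front_eq_naiveMin
    (n : ℕ) (t v : ℕ → ℝ) (w : ℝ)
    (hmono : ∀ i j, 1 ≤ i → i < j → j ≤ n → t i < t j)
    (hw : 0 < w)
    (k : ℕ) (hk1 : 1 ≤ k) (hkn : k ≤ n) :
    ∃ p rest, dequeRun w t v k = p :: rest ∧ p.2 = naiveMin w t v k := by
  obtain ⟨ha, hb, hc⟩ := dequeRun_inv n t v w hmono hw k hkn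
  obtain ⟨q, hq, -⟩ := hc k hk1 le_rfl (by linarith)
  cases hD : dequeRun w t v k with
  | nil => simp [hD] at hq
  | cons p rest =>
    rw [hD] at ha hb hc
    refine ⟨p, rest, rfl, ?_⟩
    symm
    apply IsLeast.csInf_eq
    constructor
    · obtain ⟨i, h1, h2, rfl, h3⟩ := ha p List.mem_cons_self
      refine ⟨i, ⟨h1, h2, h3, ?_⟩, rfl⟩
      rcases h2.lt_or_eq with h | rfl
      · exact (hmono i k h1 h hkn).le
      · exact le_rfl
    · rintro _ ⟨i, ⟨h1, h2, h3, -⟩, rfl⟩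
      obtain ⟨q, hq, -, hq2⟩ := hc i h1 h2 h3
      rcases List.mem_cons.1 hq with rfl | hq
      · exact hq2
      · exact ((List.pairwise_cons.1 hb).1 q hq).2.trans hq2
end

section
/- For every signal stream with strictly increasing times and every window size w > 0, the deque state Σ_k obtained after processing the first k samples contains only pairs (t_i,v_i) of the stream whose time satisfies t_k − w ≤ t_i ≤ t_k. -/
open scoped Classical

theorem dequeAux_dropWhile (c : ℝ) (D : List (ℝ × ℝ))
    (h : D.Pairwise (fun a b => a.1 < b.1)) :
    ∀ p ∈ D.dropWhile (fun p => decide (p.1 < c)), c ≤ p.1 := by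
  induction D with
  | nil => simp
  | cons a D ih =>
    rw [List.pairwise_cons] at h
    intro p hp
    by_cases ha : a.1 < c
    · rw [List.dropWhile_cons_of_pos (by simpa using ha)] at hp
      exact ih h.2 p hp
    · rw [List.dropWhile_cons_of_neg (by simpa using ha)] at hp
      rcases List.mem_cons.1 hp with rfl | hp
      · exact not_lt.1 ha
      · exact (not_lt.1 ha).trans (h.1 p hp).le

theorem dequeAux_sublist (c d : ℝ) (D : List (ℝ × ℝ)) :
    (((D.dropWhile (fun p => decide (p.1 < c))).reverse.dropWhile
      (fun p => decide (d < p.2))).reverse).Sublist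
      (D.dropWhile (fun p => decide (p.1 < c))) := by
  have := (List.dropWhile_sublist (l := (D.dropWhile (fun p => decide (p.1 < c))).reverse)
    (fun p => decide (d < p.2))).reverse
  rwa [List.reverse_reverse] at this

theorem dequeAux_inv (n : ℕ) (t v : ℕ → ℝ) (w : ℝ)
    (hmono : ∀ i j, 1 ≤ i → i < j → j ≤ n → t i < t j) (hw : 0 < w) (k : ℕ) (hkn : k ≤ n) :
    (dequeRun w t v k).Pairwise (fun a b => a.1 < b.1) ∧ ∀ p ∈ dequeRun w t v k,
      ∃ i, 1 ≤ i ∧ i ≤ k ∧ p = (t i, v i) ∧ t k - w ≤ t i ∧ t i ≤ t k := by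
  induction k with
  | zero => simp [dequeRun]
  | succ k ih =>
    obtain ⟨h1, h2⟩ := ih (by omega)
    have hs := dequeAux_sublist (t (k+1) - w) (v (k+1)) (dequeRun w t v k)
    have hs' := hs.trans (List.dropWhile_sublist _)
    have hd := dequeAux_dropWhile (t (k+1) - w) _ h1
    simp only [dequeRun, dequeStep]
    constructor
    · rw [List.pairwise_append]
      refine ⟨h1.sublist hs', List.pairwise_singleton _ _, ?_⟩
      intro a ha b hb
      obtain ⟨i, hi1, hi2, rfl, -, -⟩ := h2 a (hs'.subset ha)
      rw [List.mem_singleton.1 hb]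
      exact hmono i (k+1) hi1 (by omega) hkn
    · intro p hp
      rcases List.mem_append.1 hp with hp | hp
      · have hp' := hd p (hs.subset hp)
        obtain ⟨i, hi1, hi2, rfl, -, -⟩ := h2 p (hs'.subset hp)
        exact ⟨i, hi1, by omega, rfl, hp', (hmono i (k+1) hi1 (by omega) hkn).le⟩
      · exact ⟨k+1, by omega, le_rfl, List.mem_singleton.1 hp, by linarith, le_rfl⟩

/-- **Window-bound preservation.** For every signal stream with strictly
increasing times, every window size `w > 0`, and every step `k`, the deque state
`Σ_k` contains only pairs `(t i, v i)` of the stream whose time satisfies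
`t k - w ≤ t i ≤ t k`. -/
theorem dequeRun_mem_window
    (n : ℕ) (t v : ℕ → ℝ) (w : ℝ)
    (hmono : ∀ i j, 1 ≤ i → i < j → j ≤ n → t i < t j)
    (hw : 0 < w)
    (k : ℕ) (hkn : k ≤ n) :
    ∀ p ∈ dequeRun w t v k,
      ∃ i, 1 ≤ i ∧ i ≤ k ∧ p = (t i, v i) ∧ t k - w ≤ t i ∧ t i ≤ t k := by
  exact (dequeAux_inv n t v w hmono hw k hkn).2
end

section
/- PopBack removes only redundant candidates: in a signal stream with strictly increasing times, if indices i < k satisfy v_i > v_k, then for every future step j ≥ k such that t_i lies in the window [t_j − w, t_j], the minimum of the window is unchanged by deleting index i; that is, min{v_l : l ≤ j and t_j − w ≤ t_l ≤ t_j} = min{v_l : l ≤ j, l ≠ i, and t_j − w ≤ t_l ≤ t_j}. In particular, the pair (t_i,v_i) can never be the unique minimizer of any window containing (t_k,v_k). -/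
open scoped Classical

/-- **PopBack removes only redundant candidates.** In a stream with strictly
increasing times, if `i < k` and `v i > v k`, then for every future step
`j ≥ k` whose window `[t j - w, t j]` contains `t i`, deleting index `i` does
not change the window minimum; in particular some other in-window index attains
a value `≤ v i`, so `(t i, v i)` is never the unique minimizer of such a
window. -/
theorem popBack_redundant
    (n : ℕ) (t v : ℕ → ℝ) (w : ℝ)
    (hmono : ∀ i j, 1 ≤ i → i < j → j ≤ n → t i < t j)
    (hw : 0 < w)
    (i k : ℕ) (h1i : 1 ≤ i) (hik : i < k) (hkn : k ≤ n)
    (hvik : v k < v i)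
    (j : ℕ) (hkj : k ≤ j) (hjn : j ≤ n)
    (hwin : t j - w ≤ t i ∧ t i ≤ t j) :
    sInf (v '' {l | 1 ≤ l ∧ l ≤ j ∧ t j - w ≤ t l ∧ t l ≤ t j}) =
      sInf (v '' {l | 1 ≤ l ∧ l ≤ j ∧ l ≠ i ∧ t j - w ≤ t l ∧ t l ≤ t j}) ∧
    ∃ l, 1 ≤ l ∧ l ≤ j ∧ l ≠ i ∧ t j - w ≤ t l ∧ t l ≤ t j ∧ v l ≤ v i := by
  have htk : t i < t k := hmono i k h1i hik hkn
  have htkj : t k ≤ t j := by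
    rcases hkj.eq_or_lt with h | h
    · rw [h]
    · exact (hmono k j (by omega) h hjn).le
  have hk : 1 ≤ k ∧ k ≤ j ∧ k ≠ i ∧ t j - w ≤ t k ∧ t k ≤ t j :=
    ⟨by omega, hkj, by omega, by linarith [hwin.1], htkj⟩
  have hfin : (v '' {l | 1 ≤ l ∧ l ≤ j ∧ t j - w ≤ t l ∧ t l ≤ t j}).Finite :=
    ((Set.finite_Iic j).subset (fun l hl => hl.2.1)).image v
  have hsub : v '' {l | 1 ≤ l ∧ l ≤ j ∧ l ≠ i ∧ t j - w ≤ t l ∧ t l ≤ t j} ⊆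
      v '' {l | 1 ≤ l ∧ l ≤ j ∧ t j - w ≤ t l ∧ t l ≤ t j} :=
    Set.image_mono (fun l hl => ⟨hl.1, hl.2.1, hl.2.2.2⟩)
  have hne : (v '' {l | 1 ≤ l ∧ l ≤ j ∧ l ≠ i ∧ t j - w ≤ t l ∧ t l ≤ t j}).Nonempty :=
    ⟨v k, k, hk, rfl⟩
  refine ⟨le_antisymm (csInf_le_csInf hfin.bddBelow hne hsub) ?_,
    k, hk.1, hk.2.1, hk.2.2.1, hk.2.2.2.1, hk.2.2.2.2, hvik.le⟩
  have hbdd := hfin.bddBelow.mono hsub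
  apply le_csInf (hne.mono hsub)
  rintro _ ⟨l, hl, rfl⟩
  by_cases h : l = i
  · rw [h]
    exact (csInf_le hbdd ⟨k, hk, rfl⟩).trans hvik.le
  · exact csInf_le hbdd ⟨l, ⟨hl.1, hl.2.1, h, hl.2.2⟩, rfl⟩
end

section
/- Candidate completeness: for every signal stream with strictly increasing times, every window size w > 0, and every step k, each index i ≤ k with t_k − w ≤ t_i ≤ t_k whose pair (t_i,v_i) is absent from the deque state Σ_k is dominated by a later in-window index: there exists j with i < j ≤ k, t_k − w ≤ t_j ≤ t_k, and v_j ≤ v_i. Consequently the minimum of the values stored in Σ_k equals the naive sliding-window minimum at step k. -/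
open scoped Classical

theorem aux_mem_dropWhile {α : Type*} (p : α → Bool) (a : α) (l : List α)
    (h : a ∈ l) (hp : p a = false) : a ∈ l.dropWhile p := by
  induction l with
  | nil => simp at h
  | cons b l ih =>
    rw [List.dropWhile_cons]
    split
    · rename_i hb
      rcases List.mem_cons.1 h with rfl | h
      · simp [hp] at hb
      · exact ih h
    · exact h

theorem aux_dropWhile_ge (c : ℝ) (l : List (ℝ × ℝ))
    (hs : l.Pairwise (fun p q => p.1 < q.1)) :
    ∀ q ∈ l.dropWhile (fun p => decide (p.1 < c)), c ≤ q.1 := by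
  induction l with
  | nil => simp
  | cons b l ih =>
    rw [List.pairwise_cons] at hs
    rw [List.dropWhile_cons]
    split
    · exact ih hs.2
    · rename_i hb
      simp only [decide_eq_true_eq, not_lt] at hb
      intro q hq
      rcases List.mem_cons.1 hq with rfl | hq
      · exact hb
      · exact hb.trans (hs.1 q hq).le

theorem aux_sublist (w tk vk : ℝ) (D : List (ℝ × ℝ)) :
    (((D.dropWhile (fun p => decide (p.1 < tk - w))).reverse.dropWhile
      (fun p => decide (vk < p.2))).reverse).Sublist
      (D.dropWhile (fun p => decide (p.1 < tk - w))) := by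
  have h := (List.dropWhile_sublist (fun p : ℝ × ℝ => decide (vk < p.2))
    (l := (D.dropWhile (fun p => decide (p.1 < tk - w))).reverse)).reverse
  rwa [List.reverse_reverse] at h

theorem aux_inv (n : ℕ) (t v : ℕ → ℝ) (w : ℝ)
    (hmono : ∀ i j, 1 ≤ i → i < j → j ≤ n → t i < t j) (hw : 0 < w) (k : ℕ) (hkn : k ≤ n) :
    (dequeRun w t v k).Pairwise (fun p q => p.1 < q.1) ∧
    ∀ p ∈ dequeRun w t v k, t k - w ≤ p.1 ∧ ∃ i, 1 ≤ i ∧ i ≤ k ∧ p = (t i, v i) := by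
  induction k with
  | zero => simp [dequeRun]
  | succ k ih =>
    obtain ⟨hs, hm⟩ := ih (by omega)
    have hsub := aux_sublist w (t (k+1)) (v (k+1)) (dequeRun w t v k)
    have hsub2 := hsub.trans (List.dropWhile_sublist _)
    rw [dequeRun, dequeStep]
    refine ⟨?_, ?_⟩
    · rw [List.pairwise_append]
      refine ⟨hs.sublist hsub2, by simp, ?_⟩
      intro a ha b hb
      obtain ⟨_, i, h1, h2, rfl⟩ := hm a (hsub2.subset ha)
      rw [List.mem_singleton] at hb
      subst hb
      exact hmono i (k+1) h1 (by omega) hkn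
    · intro p hp
      rcases List.mem_append.1 hp with hp | hp
      · refine ⟨aux_dropWhile_ge _ _ hs p (hsub.subset hp), ?_⟩
        obtain ⟨_, i, h1, h2, h3⟩ := hm p (hsub2.subset hp)
        exact ⟨i, h1, by omega, h3⟩
      · rw [List.mem_singleton] at hp
        subst hp
        exact ⟨by simp only; linarith, k+1, by omega, le_rfl, rfl⟩

theorem aux_dom (n : ℕ) (t v : ℕ → ℝ) (w : ℝ)
    (hmono : ∀ i j, 1 ≤ i → i < j → j ≤ n → t i < t j) (k : ℕ) (hkn : k ≤ n) :
    ∀ i, 1 ≤ i → i ≤ k → t k - w ≤ t i →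
      (t i, v i) ∈ dequeRun w t v k ∨ ∃ j, i < j ∧ j ≤ k ∧ v j ≤ v i := by
  induction k with
  | zero => intro i h1 h2; omega
  | succ k ih =>
    intro i h1 h2 h3
    rw [dequeRun, dequeStep]
    rcases Nat.lt_or_ge k i with hik | hik
    · obtain rfl : i = k + 1 := by omega
      left; simp
    · have hk := hmono k (k+1) (by omega) (by omega) hkn
      rcases ih (by omega) i h1 hik (by linarith) with h | ⟨j, hj1, hj2, hj3⟩
      · by_cases hv : v (k+1) < v i
        · exact Or.inr ⟨k+1, by omega, le_rfl, hv.le⟩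
        · left
          apply List.mem_append_left
          rw [List.mem_reverse]
          apply aux_mem_dropWhile _ _ _ _ (by simpa using hv)
          rw [List.mem_reverse]
          exact aux_mem_dropWhile _ _ _ h (by simpa using h3)
      · exact Or.inr ⟨j, hj1, by omega, hj3⟩

/-- **Candidate completeness.** Every in-window index whose pair is absent from
the deque state `Σ_k` is dominated by a later in-window index with value `≤`
its own; consequently, the minimum of the values stored in `Σ_k` equals the
naive sliding-window minimum at step `k`. -/
theorem candidate_completeness
    (n : ℕ) (t v : ℕ → ℝ) (w : ℝ)
    (hmono : ∀ i j, 1 ≤ i → i < j → j ≤ n → t i < t j)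
    (hw : 0 < w)
    (k : ℕ) (hk1 : 1 ≤ k) (hkn : k ≤ n) :
    (∀ i, 1 ≤ i → i ≤ k → t k - w ≤ t i → t i ≤ t k →
        (t i, v i) ∉ dequeRun w t v k →
        ∃ j, i < j ∧ j ≤ k ∧ t k - w ≤ t j ∧ t j ≤ t k ∧ v j ≤ v i) ∧
    sInf {x : ℝ | ∃ p ∈ dequeRun w t v k, p.2 = x} = naiveMin w t v k := by
  have hle : ∀ i j, 1 ≤ i → i ≤ j → j ≤ n → t i ≤ t j := by
    intro i j h1 h2 h3
    rcases h2.eq_or_lt with rfl | h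
    · exact le_rfl
    · exact (hmono i j h1 h h3).le
  have hdom := aux_dom n t v w hmono k hkn
  obtain ⟨-, hm⟩ := aux_inv n t v w hmono hw k hkn
  refine ⟨?_, ?_⟩
  · intro i h1 h2 h3 h4 h5
    rcases hdom i h1 h2 h3 with h | ⟨j, hj1, hj2, hj3⟩
    · exact absurd h h5
    · exact ⟨j, hj1, hj2, h3.trans (hle i j h1 hj1.le (by omega)),
        hle j k (by omega) hj2 hkn, hj3⟩
  · have hex : ∀ d i, k - i = d → 1 ≤ i → i ≤ k → t k - w ≤ t i →
        ∃ p ∈ dequeRun w t v k, p.2 ≤ v i := by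
      intro d
      induction d using Nat.strong_induction_on with
      | _ d ih =>
        intro i hd h1 h2 h3
        rcases hdom i h1 h2 h3 with h | ⟨j, hj1, hj2, hj3⟩
        · exact ⟨_, h, le_rfl⟩
        · obtain ⟨p, hp, hpv⟩ := ih (k - j) (by omega) j rfl (by omega) hj2
            (h3.trans (hle i j h1 hj1.le (by omega)))
          exact ⟨p, hp, hpv.trans hj3⟩
    have hsub : {x : ℝ | ∃ p ∈ dequeRun w t v k, p.2 = x} ⊆
        v '' {i | 1 ≤ i ∧ i ≤ k ∧ t k - w ≤ t i ∧ t i ≤ t k} := by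
      rintro x ⟨p, hp, rfl⟩
      obtain ⟨h, i, h1, h2, rfl⟩ := hm p hp
      exact ⟨i, ⟨h1, h2, h, hle i k h1 h2 hkn⟩, rfl⟩
    have hbdd : BddBelow (v '' {i | 1 ≤ i ∧ i ≤ k ∧ t k - w ≤ t i ∧ t i ≤ t k}) := by
      apply Set.Finite.bddBelow
      apply Set.Finite.image
      exact (Set.finite_Icc 1 k).subset (fun i hi => ⟨hi.1, hi.2.1⟩)
    obtain ⟨p0, hp0, _⟩ := hex (k - k) k rfl hk1 le_rfl (by linarith)
    have hne : {x : ℝ | ∃ p ∈ dequeRun w t v k, p.2 = x}.Nonempty := ⟨p0.2, p0, hp0, rfl⟩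
    rw [naiveMin]
    apply le_antisymm
    · apply le_csInf (hne.mono hsub)
      rintro x ⟨i, ⟨h1, h2, h3, h4⟩, rfl⟩
      obtain ⟨p, hp, hpv⟩ := hex (k - i) i rfl h1 h2 h3
      exact (csInf_le (hbdd.mono hsub) ⟨p, hp, rfl⟩).trans hpv
    · exact csInf_le_csInf hbdd hne hsub
end

section
/- Bounded space: for every signal stream with strictly increasing times, every window size w > 0, and every step k, the length of the deque state Σ_k is at most the number of samples whose times fall in the window [t_k − w, t_k]; in particular, if every window of width w contains at most m samples of the stream, the deque never holds more than m elements. -/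
open scoped Classical

lemma le_of_mem_dropWhile_sorted (c : ℝ) (D : List (ℝ × ℝ))
    (h : D.Pairwise (fun p q => p.1 < q.1)) :
    ∀ p ∈ D.dropWhile (fun p => decide (p.1 < c)), c ≤ p.1 := by
  induction D with
  | nil => simp
  | cons a D ih =>
    rw [List.pairwise_cons] at h
    intro p hp
    by_cases ha : a.1 < c
    · rw [List.dropWhile_cons_of_pos (by simpa using ha)] at hp
      exact ih h.2 p hp
    · rw [List.dropWhile_cons_of_neg (by simpa using ha)] at hp
      rcases List.mem_cons.1 hp with rfl | hp
      · exact not_lt.1 ha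
      · exact (not_lt.1 ha).trans (h.1 p hp).le

lemma dequeRun_invariant (n : ℕ) (t v : ℕ → ℝ) (w : ℝ)
    (hmono : ∀ i j, 1 ≤ i → i < j → j ≤ n → t i < t j) (hw : 0 < w)
    (k : ℕ) (hkn : k ≤ n) :
    (dequeRun w t v k).Pairwise (fun p q => p.1 < q.1) ∧
    ∀ p ∈ dequeRun w t v k, ∃ i, 1 ≤ i ∧ i ≤ k ∧ p.1 = t i ∧ t k - w ≤ t i := by
  induction k with
  | zero => simp [dequeRun]
  | succ k ih =>
    obtain ⟨hs, hm⟩ := ih (by omega)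
    have hpop := le_of_mem_dropWhile_sorted (t (k+1) - w) _ hs
    simp only [dequeRun, dequeStep]
    set D := dequeRun w t v k
    set E := D.dropWhile (fun p => decide (p.1 < t (k+1) - w)) with hE
    set F := (E.reverse.dropWhile (fun p => decide (v (k+1) < p.2))).reverse with hF
    have hED : E.Sublist D := List.dropWhile_sublist _
    have hFE : F.Sublist E := by
      have := (List.dropWhile_sublist (l := E.reverse)
        (fun p : ℝ × ℝ => decide (v (k+1) < p.2))).reverse
      rwa [List.reverse_reverse] at this
    refine ⟨?_, ?_⟩
    · rw [List.pairwise_append]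
      refine ⟨hs.sublist (hFE.trans hED), by simp, ?_⟩
      intro a ha b hb
      rw [List.mem_singleton] at hb
      subst hb
      obtain ⟨i, h1, h2, h3, _⟩ := hm a ((hFE.trans hED).subset ha)
      rw [h3]
      exact hmono i (k+1) h1 (by omega) hkn
    · intro p hp
      rcases List.mem_append.1 hp with hp | hp
      · obtain ⟨i, h1, h2, h3, _⟩ := hm p ((hFE.trans hED).subset hp)
        exact ⟨i, h1, by omega, h3, h3 ▸ hpop p (hFE.subset hp)⟩
      · rw [List.mem_singleton] at hp
        subst hp
        exact ⟨k+1, by omega, le_rfl, rfl, by linarith⟩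

/-- **Bounded space.** The length of the deque state `Σ_k` is at most the
number of samples whose times fall in the window `[t k - w, t k]`; in
particular, if every window of width `w` contains at most `m` samples of the
stream, the deque never holds more than `m` elements. -/
theorem bounded_space
    (n : ℕ) (t v : ℕ → ℝ) (w : ℝ)
    (hmono : ∀ i j, 1 ≤ i → i < j → j ≤ n → t i < t j)
    (hw : 0 < w)
    (k : ℕ) (hkn : k ≤ n) :
    (dequeRun w t v k).length ≤
      ((Finset.Icc 1 k).filter (fun i => t k - w ≤ t i ∧ t i ≤ t k)).card ∧
    ∀ m : ℕ,
      (∀ j, 1 ≤ j → j ≤ n →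
        ((Finset.Icc 1 j).filter (fun i => t j - w ≤ t i ∧ t i ≤ t j)).card ≤ m) →
      (dequeRun w t v k).length ≤ m := by
  have key : (dequeRun w t v k).length ≤
      ((Finset.Icc 1 k).filter (fun i => t k - w ≤ t i ∧ t i ≤ t k)).card := by
    obtain ⟨hs, hm⟩ := dequeRun_invariant n t v w hmono hw k hkn
    have hnd : ((dequeRun w t v k).map Prod.fst).Nodup := by
      rw [List.Nodup, List.pairwise_map]
      exact hs.imp (fun h => h.ne)
    rw [← List.length_map (f := Prod.fst), ← List.toFinset_card_of_nodup hnd]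
    refine (Finset.card_le_card (t := ((Finset.Icc 1 k).filter
      (fun i => t k - w ≤ t i ∧ t i ≤ t k)).image t) ?_).trans Finset.card_image_le
    intro x hx
    rw [List.mem_toFinset, List.mem_map] at hx
    obtain ⟨p, hp, rfl⟩ := hx
    obtain ⟨i, h1, h2, h3, h4⟩ := hm p hp
    rw [Finset.mem_image]
    refine ⟨i, ?_, h3.symm⟩
    rw [Finset.mem_filter, Finset.mem_Icc]
    refine ⟨⟨h1, h2⟩, h4, ?_⟩
    rcases h2.eq_or_lt with rfl | h
    · exact le_rfl
    · exact (hmono i k h1 h hkn).le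
  refine ⟨key, fun m hm => ?_⟩
  rcases Nat.eq_zero_or_pos k with rfl | hk
  · simp [dequeRun]
  · exact key.trans (hm k hk hkn)
end
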